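/- Let g be a finite-dimensional real Lie algebra, let a be an abelian real Lie algebra, and let δ : a → Der(g) be a Lie algebra homomorphism such that each δ_H (H ∈ a) is a semisimple linear endomorphism of g. Let g₁ = g ⊕ a be the semidirect product with bracket ⁅(X, H), (X', H')⁆ = (⁅X, X'⁆ + δ_H(X') − δ_{H'}(X), 0). If l₁ is a Levi subalgebra of g₁ invariant under ad(H) for all H ∈ a, then l₁ ⊆ g, l₁ is a Levi subalgebra of g, and δ_H(l₁) ⊆ l₁ for all H ∈ a. -/

import Mathlib

/-- The semidirect product `g ⊕ a` of a Lie algebra `g` by a Lie algebra `a` acting on `g`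
via a homomorphism `δ : a → Der(g)`.  As a type (and as a vector space) it is `g × a`. -/
def LieSemidirectProduct (g a : Type*) [LieRing g] [LieAlgebra ℝ g]
    [LieRing a] [LieAlgebra ℝ a] (δ : a →ₗ⁅ℝ⁆ LieDerivation ℝ g g) : Type _ := g × a

namespace LieSemidirectProduct

variable {g a : Type*} [LieRing g] [LieAlgebra ℝ g] [LieRing a] [LieAlgebra ℝ a]
  (δ : a →ₗ⁅ℝ⁆ LieDerivation ℝ g g)

instance : AddCommGroup (LieSemidirectProduct g a δ) :=
  inferInstanceAs (AddCommGroup (g × a))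

instance : Module ℝ (LieSemidirectProduct g a δ) :=
  inferInstanceAs (Module ℝ (g × a))

/-- The first (i.e. `g`) component. -/
def fst (x : LieSemidirectProduct g a δ) : g := Prod.fst (x : g × a)

/-- The second (i.e. `a`) component. -/
def snd (x : LieSemidirectProduct g a δ) : a := Prod.snd (x : g × a)

/-- Build an element of the semidirect product from its components. -/
def mk (X : g) (H : a) : LieSemidirectProduct g a δ := ((X, H) : g × a)

@[simp] lemma fst_mk (X : g) (H : a) : fst δ (mk δ X H) = X := rfl
@[simp] lemma snd_mk (X : g) (H : a) : snd δ (mk δ X H) = H := rfl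

@[ext] lemma ext {x y : LieSemidirectProduct g a δ}
    (h1 : fst δ x = fst δ y) (h2 : snd δ x = snd δ y) : x = y :=
  Prod.ext h1 h2

@[simp] lemma fst_add (x y : LieSemidirectProduct g a δ) :
    fst δ (x + y) = fst δ x + fst δ y := rfl
@[simp] lemma snd_add (x y : LieSemidirectProduct g a δ) :
    snd δ (x + y) = snd δ x + snd δ y := rfl
@[simp] lemma fst_smul (t : ℝ) (x : LieSemidirectProduct g a δ) :
    fst δ (t • x) = t • fst δ x := rfl
@[simp] lemma snd_smul (t : ℝ) (x : LieSemidirectProduct g a δ) :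
    snd δ (t • x) = t • snd δ x := rfl
@[simp] lemma fst_zero : fst δ (0 : LieSemidirectProduct g a δ) = 0 := rfl
@[simp] lemma snd_zero : snd δ (0 : LieSemidirectProduct g a δ) = 0 := rfl

instance : Bracket (LieSemidirectProduct g a δ) (LieSemidirectProduct g a δ) where
  bracket x y :=
    mk δ (⁅fst δ x, fst δ y⁆ + δ (snd δ x) (fst δ y) - δ (snd δ y) (fst δ x))
      ⁅snd δ x, snd δ y⁆

@[simp] lemma fst_bracket (x y : LieSemidirectProduct g a δ) :
    fst δ ⁅x, y⁆ = ⁅fst δ x, fst δ y⁆ + δ (snd δ x) (fst δ y) - δ (snd δ y) (fst δ x) := rfl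

@[simp] lemma snd_bracket (x y : LieSemidirectProduct g a δ) :
    snd δ ⁅x, y⁆ = ⁅snd δ x, snd δ y⁆ := rfl

instance : LieRing (LieSemidirectProduct g a δ) where
  add_lie x y z := by
    ext <;> simp [add_lie, lie_add, map_add] <;> abel
  lie_add x y z := by
    ext <;> simp [add_lie, lie_add, map_add] <;> abel
  lie_self x := by
    ext <;> simp
  leibniz_lie x y z := by
    ext
    · simp only [fst_bracket, snd_bracket, fst_add, snd_add, lie_add, add_lie, lie_sub, sub_lie,
        map_add, map_sub, LieHom.map_lie, LieDerivation.commutator_apply,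
        LieDerivation.apply_lie_eq_add, lie_lie]
      rw [show ⁅(δ (snd δ z)) (fst δ x), fst δ y⁆
            = -⁅fst δ y, (δ (snd δ z)) (fst δ x)⁆ from (lie_skew _ _).symm]
      abel
    · simp only [fst_bracket, snd_bracket, fst_add, snd_add]
      exact leibniz_lie _ _ _

instance : LieAlgebra ℝ (LieSemidirectProduct g a δ) where
  lie_smul t x y := by
    ext <;> simp [lie_smul, smul_lie, map_smul, smul_add, smul_sub]

instance [FiniteDimensional ℝ g] [FiniteDimensional ℝ a] :
    FiniteDimensional ℝ (LieSemidirectProduct g a δ) :=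
  inferInstanceAs (FiniteDimensional ℝ (g × a))

/-- The canonical embedding of `g` into the semidirect product, as a linear map. -/
def inl : g →ₗ[ℝ] LieSemidirectProduct g a δ where
  toFun X := mk δ X 0
  map_add' X Y := by ext <;> simp
  map_smul' t X := by ext <;> simp

@[simp] lemma inl_apply (X : g) : inl δ X = mk δ X 0 := rfl

end LieSemidirectProduct

/-- `l` is a Levi subalgebra of `L`: a semisimple Lie subalgebra that is a vector-space
complement of the radical of `L`. -/
def IsLeviSubalgebra (L : Type*) [LieRing L] [LieAlgebra ℝ L]
    (l : LieSubalgebra ℝ L) : Prop :=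
  LieAlgebra.IsSemisimple ℝ l ∧
    IsCompl l.toSubmodule (LieAlgebra.radical ℝ L).toSubmodule

/-- The order isomorphism of ideal lattices induced by an isomorphism of Lie algebras. -/
def LieEquiv.lieIdealOrderIso {R L L' : Type*} [CommRing R] [LieRing L] [LieAlgebra R L]
    [LieRing L'] [LieAlgebra R L'] (e : L ≃ₗ⁅R⁆ L') : LieIdeal R L ≃o LieIdeal R L' where
  toFun I := I.comap e.symm.toLieHom
  invFun I := I.comap e.toLieHom
  left_inv I := by ext; simp
  right_inv I := by ext; simp
  map_rel_iff' {I J} := by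
    refine ⟨fun h x hx ↦ ?_, fun h x hx ↦ h hx⟩
    have := @h (e x)
    simp_all

namespace LieAlgebra

/-- An ideal which is the preimage of an abelian ideal under an isomorphism is abelian. -/
lemma isLieAbelian_comap_equiv {R L L' : Type*} [CommRing R] [LieRing L] [LieAlgebra R L]
    [LieRing L'] [LieAlgebra R L'] (e : L ≃ₗ⁅R⁆ L') (I : LieIdeal R L') (hI : IsLieAbelian I) :
    IsLieAbelian (I.comap e.toLieHom) := by
  rw [LieSubmodule.lie_abelian_iff_lie_self_eq_bot, LieSubmodule.lie_eq_bot_iff] at hI ⊢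
  intro x hx y hy
  apply e.injective
  simpa using hI (e x) hx (e y) hy

/-- Semisimplicity is invariant under isomorphisms of Lie algebras. -/
lemma IsSemisimple.of_equiv {R L L' : Type*} [CommRing R] [LieRing L] [LieAlgebra R L]
    [LieRing L'] [LieAlgebra R L'] (e : L ≃ₗ⁅R⁆ L') [IsSemisimple R L] : IsSemisimple R L' := by
  have himg : {I : LieIdeal R L' | IsAtom I} =
      e.lieIdealOrderIso '' {I : LieIdeal R L | IsAtom I} := by
    ext I
    constructor
    · intro hI
      exact ⟨e.lieIdealOrderIso.symm I, (e.lieIdealOrderIso.symm.isAtom_iff I).mpr hI, by simp⟩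
    · rintro ⟨J, hJ, rfl⟩
      exact (e.lieIdealOrderIso.isAtom_iff J).mpr hJ
  refine ⟨?_, ?_, fun I hI hab ↦ ?_⟩
  · rw [himg, sSup_image, ← OrderIso.map_sSup, sSup_atoms_eq_top, map_top]
  · rw [himg, Set.image_eq_range]
    exact (((sSupIndep_iff _).mp sSupIndep_isAtom).map_orderIso e.lieIdealOrderIso).sSupIndep_range
  · exact non_abelian_of_isAtom (R := R) (L := L) _
      ((e.lieIdealOrderIso.symm.isAtom_iff I).mpr hI) (isLieAbelian_comap_equiv e I hab)

/-- A semisimple Lie algebra is perfect. -/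
lemma IsSemisimple.lie_top_eq_top (R L : Type*) [CommRing R] [LieRing L] [LieAlgebra R L]
    [IsSemisimple R L] : ⁅(⊤ : LieIdeal R L), (⊤ : LieIdeal R L)⁆ = ⊤ := by
  refine eq_top_iff.mpr (sSup_atoms_eq_top.symm.trans_le (sSup_le fun I hI ↦ ?_))
  rw [← lie_eq_self_of_isAtom_of_nonabelian I hI (non_abelian_of_isAtom I hI)]
  exact LieSubmodule.mono_lie le_top le_top

/-- A homomorphism from a semisimple Lie algebra to an abelian one vanishes. -/
lemma IsSemisimple.lieHom_apply_eq_zero {R L A : Type*} [CommRing R] [LieRing L] [LieAlgebra R L]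
    [LieRing A] [LieAlgebra R A] [IsSemisimple R L] [IsLieAbelian A] (f : L →ₗ⁅R⁆ A) (x : L) :
    f x = 0 := by
  rw [← LieHom.mem_ker]
  suffices (⊤ : LieIdeal R L) ≤ f.ker from this (LieSubmodule.mem_top x)
  rw [← lie_top_eq_top R L, LieSubmodule.lie_le_iff]
  intro x _ y _
  simp [trivial_lie_zero]

/-- A semisimple subalgebra meets the radical trivially. -/
lemma disjoint_radical_of_isSemisimple {R L : Type*} [CommRing R] [LieRing L] [LieAlgebra R L]
    [IsNoetherian R L] (l : LieSubalgebra R L) [IsSemisimple R l] :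
    Disjoint l.toSubmodule (radical R L).toSubmodule := by
  have hsol : IsSolvable ((radical R L).comap l.incl) := by
    let f : (radical R L).comap l.incl →ₗ⁅R⁆ radical R L :=
      { toFun x := ⟨x, x.2⟩
        map_add' _ _ := rfl
        map_smul' _ _ := rfl
        map_lie' := rfl }
    exact Function.Injective.lieAlgebra_isSolvable (f := f) fun x y h ↦ by
      have h' : ((x : l) : L) = ((y : l) : L) := congrArg (fun z : radical R L ↦ (z : L)) h
      exact Subtype.ext (Subtype.ext h')
  have hbot := HasTrivialRadical.eq_bot_of_isSolvable ((radical R L).comap l.incl)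
  rw [Submodule.disjoint_def]
  intro x hx hr
  have : (⟨x, hx⟩ : l) ∈ (radical R L).comap l.incl := hr
  rw [hbot] at this
  exact congrArg Subtype.val ((LieSubmodule.mem_bot _).mp this)

/-- The preimage of the radical under an injective homomorphism is contained in the radical. -/
lemma comap_radical_le_radical {R L L' : Type*} [CommRing R] [LieRing L] [LieAlgebra R L]
    [LieRing L'] [LieAlgebra R L'] [IsNoetherian R L] [IsNoetherian R L']
    (f : L →ₗ⁅R⁆ L') (hf : Function.Injective f) :
    (radical R L').comap f ≤ radical R L := by
  rw [← LieIdeal.solvable_iff_le_radical]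
  let F : (radical R L').comap f →ₗ⁅R⁆ radical R L' :=
    { toFun x := ⟨f x, x.2⟩
      map_add' _ _ := Subtype.ext (map_add f _ _)
      map_smul' _ _ := Subtype.ext (map_smul f _ _)
      map_lie' := Subtype.ext (LieHom.map_lie f _ _) }
  exact Function.Injective.lieAlgebra_isSolvable (f := F) fun x y h ↦
    Subtype.ext (hf (Subtype.ext_iff.mp h))

end LieAlgebra

namespace LieSemidirectProduct

variable {g a : Type*} [LieRing g] [LieAlgebra ℝ g] [LieRing a] [LieAlgebra ℝ a]
  (δ : a →ₗ⁅ℝ⁆ LieDerivation ℝ g g)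

/-- The canonical embedding of `g` into the semidirect product, as a Lie algebra homomorphism. -/
def inlHom : g →ₗ⁅ℝ⁆ LieSemidirectProduct g a δ where
  __ := inl δ
  map_lie' {X Y} := by ext <;> simp

@[simp] lemma inlHom_apply (X : g) : inlHom δ X = mk δ X 0 := rfl

lemma inlHom_injective : Function.Injective (inlHom δ) :=
  fun _ _ h ↦ congrArg (fst δ) h

/-- The projection of the semidirect product onto `a`, as a Lie algebra homomorphism. -/
def sndHom : LieSemidirectProduct g a δ →ₗ⁅ℝ⁆ a where
  toFun := snd δ
  map_add' := snd_add δ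
  map_smul' := snd_smul δ
  map_lie' {x y} := snd_bracket δ x y

lemma snd_eq_zero_of_mem_isSemisimple [IsLieAbelian a]
    (l : LieSubalgebra ℝ (LieSemidirectProduct g a δ)) [LieAlgebra.IsSemisimple ℝ l]
    {x : LieSemidirectProduct g a δ} (hx : x ∈ l) : snd δ x = 0 :=
  LieAlgebra.IsSemisimple.lieHom_apply_eq_zero ((sndHom δ).comp l.incl) ⟨x, hx⟩

end LieSemidirectProduct

open LieSemidirectProduct in
/-- If each `δ_H` is a semisimple endomorphism and `l₁` is an `ad(a)`-invariant Levi subalgebra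
of the semidirect product `g₁ = g ⊕ a`, then `l₁ ⊆ g`, `l₁` is a Levi subalgebra of `g`, and
`l₁` is `δ_H`-invariant for every `H ∈ a`. -/
theorem levi_of_semidirect_contained_in_ideal
    (g a : Type*) [LieRing g] [LieAlgebra ℝ g] [FiniteDimensional ℝ g]
    [LieRing a] [LieAlgebra ℝ a] [FiniteDimensional ℝ a] [IsLieAbelian a]
    (δ : a →ₗ⁅ℝ⁆ LieDerivation ℝ g g)
    (hss : ∀ H : a, Module.End.IsSemisimple ((δ H).toLinearMap : Module.End ℝ g))
    (l₁ : LieSubalgebra ℝ (LieSemidirectProduct g a δ))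
    (hlevi : IsLeviSubalgebra (LieSemidirectProduct g a δ) l₁)
    (hinv : ∀ H : a, ∀ x ∈ l₁, ⁅mk δ 0 H, x⁆ ∈ l₁) :
    l₁.toSubmodule ≤ LinearMap.range (inl δ) ∧
      ∃ l : LieSubalgebra ℝ g,
        Submodule.map (inl δ) l.toSubmodule = l₁.toSubmodule ∧
        IsLeviSubalgebra g l ∧
        ∀ H : a, ∀ x ∈ l, δ H x ∈ l := by
  obtain ⟨hsemi, hcompl⟩ := hlevi
  have hmk : ∀ x, snd δ x = 0 → mk δ (fst δ x) 0 = x := fun x hx ↦ by ext <;> simp [hx]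
  have hsnd : ∀ x ∈ l₁, snd δ x = 0 := fun x hx ↦ snd_eq_zero_of_mem_isSemisimple δ l₁ hx
  have hmap : (l₁.comap (inlHom δ)).map (inlHom δ) = l₁ := by
    ext x
    constructor
    · rintro ⟨X, hX, rfl⟩
      exact hX
    · intro hx
      exact ⟨fst δ x, by simpa [hmk x (hsnd x hx)] using hx, hmk x (hsnd x hx)⟩
  let e : l₁.comap (inlHom δ) ≃ₗ⁅ℝ⁆ l₁ :=
    (LieSubalgebra.equivMapOfInjective _ _ (inlHom_injective δ)).trans
      (LieEquiv.ofEq _ _ (congrArg _ hmap))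
  have : LieAlgebra.IsSemisimple ℝ (l₁.comap (inlHom δ)) := .of_equiv e.symm
  refine ⟨fun x hx ↦ ⟨fst δ x, hmk x (hsnd x hx)⟩, l₁.comap (inlHom δ),
    congrArg LieSubalgebra.toSubmodule hmap,
    ⟨this, LieAlgebra.disjoint_radical_of_isSemisimple _, ?_⟩, fun H x hx ↦ ?_⟩
  · rw [codisjoint_iff, Submodule.eq_top_iff']
    intro X
    obtain ⟨y, hy, r, hr, hyr⟩ := Submodule.mem_sup.mp
      (hcompl.sup_eq_top ▸ Submodule.mem_top : mk δ X 0 ∈ _)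
    have hy0 := hsnd y hy
    have hr0 : snd δ r = 0 := by simpa [hy0] using congrArg (snd δ) hyr
    refine Submodule.mem_sup.mpr ⟨fst δ y, ?_, fst δ r, ?_, congrArg (fst δ) hyr⟩
    · change mk δ (fst δ y) 0 ∈ l₁
      rwa [hmk y hy0]
    · apply LieAlgebra.comap_radical_le_radical (inlHom δ) (inlHom_injective δ)
      change mk δ (fst δ r) 0 ∈ LieAlgebra.radical ℝ _
      rwa [hmk r hr0]
  · have h := hinv H (mk δ x 0) hx
    rwa [show ⁅mk δ 0 H, mk δ x 0⁆ = mk δ (δ H x) 0 by ext <;> simp] at h
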